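/- Let R = ℤ[x,x⁻¹], let n ≥ 2 be an integer, let M₀ = R/(x − n), and let M₁ be an R-module whose underlying abelian group is free. Then Ext²_R(M₀, M₁) = 0 and Ext²_R(M₁, M₀) = 0. -/

import Mathlib

/-!
STATEMENT 9: Let R = ℤ[x,x⁻¹], let n ≥ 2 be an integer, let M₀ = R/(x − n), and let M₁ be an
R-module whose underlying abelian group is free. Then Ext²_R(M₀, M₁) = 0 and Ext²_R(M₁, M₀) = 0.
-/

open CategoryTheory

noncomputable section

attribute [local instance] HasDerivedCategory.standard

instance (A : Type) [Ring A] : HasExt.{1} (ModuleCat.{0} A) :=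
  hasExt_of_hasDerivedCategory _

open scoped TensorProduct LaurentPolynomial

/-- A module with a length one resolution by projective modules has projective dimension at most
one. -/
lemma hasProjectiveDimensionLE_one_of_exact {A P Q N : Type} [CommRing A]
    [AddCommGroup P] [AddCommGroup Q] [AddCommGroup N] [Module A P] [Module A Q] [Module A N]
    [Module.Projective A P] [Module.Projective A Q] {f : P →ₗ[A] Q} {g : Q →ₗ[A] N}
    (hf : Function.Injective f) (hfg : Function.Exact f g) (hg : Function.Surjective g) :
    HasProjectiveDimensionLE (ModuleCat.of A N) 1 := by
  let S : ShortComplex (ModuleCat.{0} A) :=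
    .mk (ModuleCat.ofHom f) (ModuleCat.ofHom g) (by ext x; exact hfg.apply_apply_eq_zero x)
  have hS : S.ShortExact := ModuleCat.shortComplex_shortExact S hfg hf hg
  have hP : Projective S.X₁ := ModuleCat.projective_of_categoryTheory_projective _
  have hQ : Projective S.X₂ := ModuleCat.projective_of_categoryTheory_projective _
  exact hS.hasProjectiveDimensionLT_X₃ 1 inferInstance inferInstance

/-- The quotient of a commutative ring by a nonzerodivisor has projective dimension at most one. -/
lemma hasProjectiveDimensionLE_one_quotient_span_singleton {A : Type} [CommRing A] [IsDomain A]
    {a : A} (ha : a ≠ 0) : HasProjectiveDimensionLE (ModuleCat.of A (A ⧸ Ideal.span {a})) 1 := by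
  refine hasProjectiveDimensionLE_one_of_exact (f := LinearMap.mulLeft A a)
    (g := (Ideal.span {a}).mkQ) (mul_right_injective₀ ha) (fun x ↦ ?_)
    (Submodule.mkQ_surjective _)
  rw [Submodule.mkQ_apply, Submodule.Quotient.mk_eq_zero, Ideal.mem_span_singleton]
  simp [dvd_def, eq_comm]

namespace LaurentPolynomial

variable (k M : Type) [CommRing k] [AddCommGroup M] [Module k M] [Module k[T;T⁻¹] M]
  [IsScalarTower k k[T;T⁻¹] M]

/-- The endomorphism `f ⊗ m ↦ T f ⊗ m - f ⊗ T m` of `k[T;T⁻¹] ⊗ M`. -/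
def twistedDifference : k[T;T⁻¹] ⊗[k] M →ₗ[k[T;T⁻¹]] k[T;T⁻¹] ⊗[k] M :=
  LinearMap.lsmul k[T;T⁻¹] _ (T 1) -
    ((LinearMap.lsmul k[T;T⁻¹] M (T 1)).restrictScalars k).baseChange k[T;T⁻¹]

/-- The action map `f ⊗ m ↦ f m`. -/
def actionMap : k[T;T⁻¹] ⊗[k] M →ₗ[k[T;T⁻¹]] M :=
  LinearMap.liftBaseChange k[T;T⁻¹] LinearMap.id

variable {k M}

@[simp]
lemma twistedDifference_tmul (f : k[T;T⁻¹]) (m : M) :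
    twistedDifference k M (f ⊗ₜ m) = (T 1 * f) ⊗ₜ m - f ⊗ₜ ((T 1 : k[T;T⁻¹]) • m) := by
  simp [twistedDifference, TensorProduct.smul_tmul']

@[simp]
lemma actionMap_tmul (f : k[T;T⁻¹]) (m : M) : actionMap k M (f ⊗ₜ m) = f • m := by
  simp [actionMap]

lemma twistedDifference_injective : Function.Injective (twistedDifference k M) := by
  classical
  let e : k[T;T⁻¹] ⊗[k] M ≃ₗ[k] ℤ →₀ M :=
    TensorProduct.equivFinsuppOfBasisLeft (AddMonoidAlgebra.basis ℤ k)
  have he (z : k[T;T⁻¹] ⊗[k] M) (i : ℤ) :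
      e (twistedDifference k M z) i = e z (i - 1) - (T 1 : k[T;T⁻¹]) • e z i := by
    induction z with
    | zero => simp
    | add x y hx hy => simp only [map_add, Finsupp.add_apply, hx, hy, smul_add]; abel
    | tmul f m =>
      have hT : (T 1 * f).coeff i = f.coeff (i - 1) := by
        exact AddMonoidAlgebra.coeff_single_mul_eq_mul_coeff _ (by grind) |>.trans (one_mul _)
      have hrepr (p : k[T;T⁻¹]) (j : ℤ) : (AddMonoidAlgebra.basis ℤ k).repr p j = p.coeff j := rfl
      rw [twistedDifference_tmul, map_sub, Finsupp.sub_apply]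
      simp only [e, TensorProduct.equivFinsuppOfBasisLeft_apply_tmul_apply, hrepr, hT]
      rw [smul_algebra_smul_comm (f.coeff i)]
  rw [injective_iff_map_eq_zero]
  intro z hz
  have hstep (i : ℤ) : e z (i - 1) = (T 1 : k[T;T⁻¹]) • e z i := by
    have := he z i
    rw [hz, map_zero, Finsupp.zero_apply] at this
    exact (sub_eq_zero.mp this.symm)
  by_contra hne
  have hs : (e z).support.Nonempty := by simpa [Finsupp.support_nonempty_iff] using hne
  have hmin := Finset.min'_mem _ hs
  set i := (e z).support.min' hs
  have hi : e z (i - 1) = 0 := by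
    by_contra h
    have := Finset.min'_le _ _ (Finsupp.mem_support_iff.mpr h)
    omega
  rw [hstep] at hi
  exact Finsupp.mem_support_iff.mp hmin ((isUnit_T 1).smul_eq_zero.mp hi)

/-- Modulo the image of `twistedDifference`, a tensor is determined by its image under the action
map. -/
lemma sub_one_tmul_actionMap_mem_range (z : k[T;T⁻¹] ⊗[k] M) :
    z - 1 ⊗ₜ actionMap k M z ∈ LinearMap.range (twistedDifference k M) := by
  induction z with
  | zero => simp
  | add x y hx hy =>
    convert! add_mem hx hy using 1
    rw [map_add, TensorProduct.tmul_add]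
    abel
  | tmul f m =>
    rw [actionMap_tmul]
    induction f using LaurentPolynomial.induction_on generalizing m with
    | h_C a =>
      rw [show (C a : k[T;T⁻¹]) = algebraMap k k[T;T⁻¹] a from rfl, algebraMap_smul, TensorProduct.tmul_smul,
        TensorProduct.smul_tmul', Algebra.smul_def, mul_one, sub_self]
      exact zero_mem _
    | h_add hp hq =>
      convert! add_mem (hp m) (hq m) using 1
      rw [add_smul, TensorProduct.tmul_add, TensorProduct.add_tmul]
      abel
    | h_C_mul_T n a ih =>
      convert! add_mem (LinearMap.mem_range_self _ ((C a * T n) ⊗ₜ m))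
        (ih ((T 1 : k[T;T⁻¹]) • m)) using 1
      rw [twistedDifference_tmul, smul_smul, T_add, ← mul_assoc, mul_comm (T 1)]
      abel
    | h_C_mul_T_Z n a ih =>
      convert! sub_mem (ih ((T (-1) : k[T;T⁻¹]) • m)) (LinearMap.mem_range_self _
        ((C a * T (-n - 1)) ⊗ₜ ((T (-1) : k[T;T⁻¹]) • m))) using 1
      have h₁ : (T 1 : k[T;T⁻¹]) * (C a * T (-n - 1)) = C a * T (-n) := by
        rw [mul_left_comm, ← T_add, add_sub_cancel]
      have h₂ : (C a * T (-n) : k[T;T⁻¹]) * T (-1) = C a * T (-n - 1) := by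
        rw [mul_assoc, ← T_sub]
      have h₃ : (T 1 : k[T;T⁻¹]) * T (-1) = 1 := by rw [← T_add, add_neg_cancel, T_zero]
      rw [twistedDifference_tmul, smul_smul, smul_smul, h₁, h₂, h₃, one_smul]
      abel

lemma exact_twistedDifference_actionMap :
    Function.Exact (twistedDifference k M) (actionMap k M) := by
  intro z
  refine ⟨fun hz ↦ by simpa [hz] using sub_one_tmul_actionMap_mem_range z, ?_⟩
  rintro ⟨w, rfl⟩
  induction w with
  | zero => simp
  | add x y hx hy => rw [map_add, map_add, hx, hy, add_zero]
  | tmul f m => simp [mul_smul, smul_comm f]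

variable (k M) in
/-- A module over `k[T;T⁻¹]` that is projective over `k` has projective dimension at most one. -/
lemma hasProjectiveDimensionLE_one [Module.Projective k M] :
    HasProjectiveDimensionLE (ModuleCat.of k[T;T⁻¹] M) 1 :=
  hasProjectiveDimensionLE_one_of_exact twistedDifference_injective
    exact_twistedDifference_actionMap fun m ↦ ⟨1 ⊗ₜ m, by simp⟩

end LaurentPolynomial

theorem laurent_ext_two_vanishing_for_quotient_and_free
    (n : ℤ) (hn : 2 ≤ n)
    (M₁ : Type) [AddCommGroup M₁] [Module (LaurentPolynomial ℤ) M₁]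
    (hM₁ : Module.Free ℤ M₁) :
    Subsingleton (Abelian.Ext
      (ModuleCat.of (LaurentPolynomial ℤ)
        (LaurentPolynomial ℤ ⧸ Ideal.span {LaurentPolynomial.T 1 - (n : LaurentPolynomial ℤ)}))
      (ModuleCat.of (LaurentPolynomial ℤ) M₁) 2) ∧
    Subsingleton (Abelian.Ext
      (ModuleCat.of (LaurentPolynomial ℤ) M₁)
      (ModuleCat.of (LaurentPolynomial ℤ)
        (LaurentPolynomial ℤ ⧸ Ideal.span {LaurentPolynomial.T 1 - (n : LaurentPolynomial ℤ)}))
      2) := by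
  constructor
  · have h : (LaurentPolynomial.T 1 - (n : LaurentPolynomial ℤ)) ≠ 0 := by
      intro h
      have h₁ := congr_arg (fun p : LaurentPolynomial ℤ ↦ p.coeff 1) h
      rw [← map_intCast (LaurentPolynomial.C : ℤ →+* LaurentPolynomial ℤ)] at h₁
      simp [-map_intCast, -eq_intCast] at h₁
    have := hasProjectiveDimensionLE_one_quotient_span_singleton h
    exact HasProjectiveDimensionLT.subsingleton _ 2 2 le_rfl _
  · have := LaurentPolynomial.hasProjectiveDimensionLE_one ℤ M₁
    exact HasProjectiveDimensionLT.subsingleton _ 2 2 le_rfl _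

end
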